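/- (Necessity of σ ≤ α in the weighted Caffarelli–Kohn–Nirenberg inequality.) Let p, q, r, a, α, β, σ be real numbers with 1 < p < Q, q ≥ 1, r > 0, 0 < a ≤ 1, and set γ = aσ + (1−a)β. Assume d + μ(α−γ)r > 0, d + μ(α−β)q > 0, αp + Q > 0, βq + Q > 0, γr + Q > 0. If there exists a constant C > 0 such that for every u ∈ C_0^∞(ℝ^{d+k}) one has (∫_{ℝ^{d+k}} (|x|^μ/ρ^μ)^{(α−γ)r} ρ^{γr} |u|^r dx dy)^{1/r} ≤ C (∫_{ℝ^{d+k}} ρ^{αp} |∇_μ u|^p dx dy)^{a/p} (∫_{ℝ^{d+k}} (|x|^μ/ρ^μ)^{(α−β)q} ρ^{βq} |u|^q dx dy)^{(1−a)/q}, then necessarily σ ≤ α. -/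

import Mathlib

open MeasureTheory Real
open scoped RealInnerProductSpace ENNReal

/-- The anisotropic distance function `ρ(x,y) = (|x|^{2+2μ} + (1+μ)²|y|²)^{1/(2+2μ)}`. -/
noncomputable def grho (μ : ℝ) {d k : ℕ}
    (z : EuclideanSpace ℝ (Fin d) × EuclideanSpace ℝ (Fin k)) : ℝ :=
  (‖z.1‖ ^ (2 + 2 * μ) + (1 + μ) ^ 2 * ‖z.2‖ ^ 2) ^ (1 / (2 + 2 * μ))

/-- The Grushin gradient `∇_μ u = (∇_x u, |x|^μ ∇_y u)`. -/
noncomputable def gradMu (μ : ℝ) {d k : ℕ}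
    (u : EuclideanSpace ℝ (Fin d) × EuclideanSpace ℝ (Fin k) → ℝ)
    (z : EuclideanSpace ℝ (Fin d) × EuclideanSpace ℝ (Fin k)) :
    EuclideanSpace ℝ (Fin d) × EuclideanSpace ℝ (Fin k) :=
  (gradient (fun x => u (x, z.2)) z.1, (‖z.1‖ ^ μ) • gradient (fun y => u (z.1, y)) z.2)

/-- The Euclidean-type norm `((|v₁|² + |v₂|²))^{1/2}` of a pair. -/
noncomputable def pairNorm {d k : ℕ}
    (v : EuclideanSpace ℝ (Fin d) × EuclideanSpace ℝ (Fin k)) : ℝ :=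
  Real.sqrt (‖v.1‖ ^ 2 + ‖v.2‖ ^ 2)

/-- `|∇_μ u| = (|∇_x u|² + |x|^{2μ}|∇_y u|²)^{1/2}`. -/
noncomputable def gradMuNorm (μ : ℝ) {d k : ℕ}
    (u : EuclideanSpace ℝ (Fin d) × EuclideanSpace ℝ (Fin k) → ℝ)
    (z : EuclideanSpace ℝ (Fin d) × EuclideanSpace ℝ (Fin k)) : ℝ :=
  pairNorm (gradMu μ u z)

/-- If `t` is comparable to `R`, then `t ^ s` is comparable to `R ^ s`. -/
theorem exists_rpow_bounds {c₁ : ℝ} (hc₁ : 0 < c₁) (c₂ s : ℝ) :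
    ∃ m M : ℝ, 0 < m ∧ 0 < M ∧ ∀ R t : ℝ, 0 < R → c₁ * R ≤ t → t ≤ c₂ * R →
      m * R ^ s ≤ t ^ s ∧ t ^ s ≤ M * R ^ s := by
  by_cases hc₂ : 0 < c₂
  swap
  · refine ⟨1, 1, one_pos, one_pos, fun R t hR h₁ h₂ => ?_⟩
    nlinarith [mul_pos hc₁ hR]
  have hp₁ := rpow_pos_of_pos hc₁ s
  have hp₂ := rpow_pos_of_pos hc₂ s
  rcases le_total 0 s with hs | hs
  · refine ⟨c₁ ^ s, c₂ ^ s, hp₁, hp₂, fun R t hR h₁ h₂ => ?_⟩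
    have hpos : 0 < c₁ * R := mul_pos hc₁ hR
    rw [← mul_rpow hc₁.le hR.le, ← mul_rpow hc₂.le hR.le]
    exact ⟨rpow_le_rpow hpos.le h₁ hs, rpow_le_rpow (hpos.le.trans h₁) h₂ hs⟩
  · refine ⟨c₂ ^ s, c₁ ^ s, hp₂, hp₁, fun R t hR h₁ h₂ => ?_⟩
    have hpos : 0 < c₁ * R := mul_pos hc₁ hR
    rw [← mul_rpow hc₁.le hR.le, ← mul_rpow hc₂.le hR.le]
    exact ⟨rpow_le_rpow_of_nonpos (hpos.trans_le h₁) h₂ hs,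
      rpow_le_rpow_of_nonpos hpos h₁ hs⟩

section Grushin

variable {d k : ℕ}

theorem norm_fst_mem_of_mem_closedBall {e : EuclideanSpace ℝ (Fin d)} (he : ‖e‖ = 1)
    {y : EuclideanSpace ℝ (Fin k)} {z : EuclideanSpace ℝ (Fin d) × EuclideanSpace ℝ (Fin k)}
    (hz : z ∈ Metric.closedBall (e, y) (1 / 2)) : 1 / 2 ≤ ‖z.1‖ ∧ ‖z.1‖ ≤ 3 / 2 := by
  rw [Metric.mem_closedBall, Prod.dist_eq, max_le_iff, dist_eq_norm, dist_eq_norm] at hz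
  have := abs_le.1 ((abs_norm_sub_norm_le z.1 e).trans hz.1)
  constructor <;> linarith [this.1, this.2]

theorem norm_snd_mem_of_mem_closedBall {x : EuclideanSpace ℝ (Fin d)}
    {y : EuclideanSpace ℝ (Fin k)} {z : EuclideanSpace ℝ (Fin d) × EuclideanSpace ℝ (Fin k)}
    (hz : z ∈ Metric.closedBall (x, y) (1 / 2)) : ‖y‖ - 1 / 2 ≤ ‖z.2‖ ∧ ‖z.2‖ ≤ ‖y‖ + 1 / 2 := by
  rw [Metric.mem_closedBall, Prod.dist_eq, max_le_iff, dist_eq_norm, dist_eq_norm] at hz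
  have := abs_le.1 ((abs_norm_sub_norm_le z.2 y).trans hz.2)
  constructor <;> linarith [this.1, this.2]

theorem exists_grho_bounds {μ : ℝ} (hμ : 0 < μ) {e : EuclideanSpace ℝ (Fin d)} (he : ‖e‖ = 1) :
    ∃ c₁ c₂ : ℝ, 0 < c₁ ∧ ∀ R : ℝ, 1 ≤ R → ∀ y : EuclideanSpace ℝ (Fin k), ‖y‖ = R ^ (1 + μ) →
      ∀ z ∈ Metric.closedBall (e, y) (1 / 2), c₁ * R ≤ grho μ z ∧ grho μ z ≤ c₂ * R := by
  have hs : 0 < 2 + 2 * μ := by linarith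
  have hs' : 0 ≤ 1 / (2 + 2 * μ) := by positivity
  refine ⟨((1 + μ) ^ 2 / 4) ^ (1 / (2 + 2 * μ)),
    ((3 / 2) ^ (2 + 2 * μ) + (1 + μ) ^ 2 * (9 / 4)) ^ (1 / (2 + 2 * μ)), by positivity,
    fun R hR y hy z hz => ?_⟩
  have hR0 : 0 < R := by linarith
  obtain ⟨_, hx⟩ := norm_fst_mem_of_mem_closedBall he hz
  obtain ⟨hy₁, hy₂⟩ := norm_snd_mem_of_mem_closedBall hz
  have hy1 : 1 ≤ ‖y‖ := hy ▸ one_le_rpow hR (by linarith)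
  have hRR : R = (‖y‖ ^ 2) ^ (1 / (2 + 2 * μ)) := by
    rw [hy, ← rpow_natCast, ← rpow_mul hR0.le, ← rpow_mul hR0.le]
    rw [show (1 + μ) * ((2 : ℕ) : ℝ) * (1 / (2 + 2 * μ)) = 1 by push_cast; field_simp, rpow_one]
  have hxs : ‖z.1‖ ^ (2 + 2 * μ) ≤ (3 / 2) ^ (2 + 2 * μ) := rpow_le_rpow (norm_nonneg _) hx hs.le
  have hx0 : 0 ≤ ‖z.1‖ ^ (2 + 2 * μ) := by positivity
  have hx1 : (0 : ℝ) ≤ (3 / 2) ^ (2 + 2 * μ) := by positivity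
  have hy3 : ‖y‖ ^ 2 / 4 ≤ ‖z.2‖ ^ 2 := by nlinarith
  have hy4 : ‖z.2‖ ^ 2 ≤ ‖y‖ ^ 2 * (9 / 4) := by nlinarith [norm_nonneg z.2]
  have hmu : 0 ≤ (1 + μ) ^ 2 := sq_nonneg _
  unfold grho
  constructor
  · conv_lhs => rw [hRR]
    rw [← mul_rpow (by positivity) (by positivity)]
    refine rpow_le_rpow (by positivity) ?_ hs'
    nlinarith [mul_le_mul_of_nonneg_left hy3 hmu]
  · conv_rhs => rw [hRR]
    rw [← mul_rpow (by positivity) (by positivity)]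
    refine rpow_le_rpow (by positivity) ?_ hs'
    nlinarith [mul_le_mul_of_nonneg_left hy4 hmu, mul_nonneg hx1 (by nlinarith : 0 ≤ ‖y‖ ^ 2 - 1)]

theorem grho_nonneg (μ : ℝ) (z : EuclideanSpace ℝ (Fin d) × EuclideanSpace ℝ (Fin k)) :
    0 ≤ grho μ z := by
  unfold grho; positivity

/-- On balls of fixed size centred at `(e, y)` with `‖e‖ = 1` and `‖y‖ = R ^ (1 + μ)`, the weight
`(|x|^μ / ρ^μ)^A ρ^B` is comparable to `R ^ (B - μ A)`. -/
theorem exists_weight_bounds {μ : ℝ} (hμ : 0 < μ) {e : EuclideanSpace ℝ (Fin d)} (he : ‖e‖ = 1)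
    (A B : ℝ) :
    ∃ m M : ℝ, 0 < m ∧ 0 < M ∧ ∀ R : ℝ, 1 ≤ R → ∀ y : EuclideanSpace ℝ (Fin k),
      ‖y‖ = R ^ (1 + μ) → ∀ z ∈ Metric.closedBall (e, y) (1 / 2),
        m * R ^ (B - μ * A) ≤ (‖z.1‖ ^ μ / grho μ z ^ μ) ^ A * grho μ z ^ B ∧
        (‖z.1‖ ^ μ / grho μ z ^ μ) ^ A * grho μ z ^ B ≤ M * R ^ (B - μ * A) := by
  obtain ⟨c₁, c₂, hc₁, hc⟩ := exists_grho_bounds (k := k) hμ he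
  obtain ⟨m₁, M₁, hm₁, hM₁, H₁⟩ := exists_rpow_bounds (c₁ := 1 / 2) (by norm_num) (3 / 2) (μ * A)
  obtain ⟨m₂, M₂, hm₂, hM₂, H₂⟩ := exists_rpow_bounds hc₁ c₂ (B - μ * A)
  refine ⟨m₁ * m₂, M₁ * M₂, by positivity, by positivity, fun R hR y hy z hz => ?_⟩
  have hR0 : 0 < R := by linarith
  obtain ⟨hρ₁, hρ₂⟩ := hc R hR y hy z hz
  obtain ⟨hx₁, hx₂⟩ := norm_fst_mem_of_mem_closedBall he hz
  have hρ : 0 < grho μ z := (mul_pos hc₁ hR0).trans_le hρ₁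
  obtain ⟨a₁, b₁⟩ := H₁ 1 ‖z.1‖ one_pos (by linarith) (by linarith)
  obtain ⟨a₂, b₂⟩ := H₂ R _ hR0 hρ₁ hρ₂
  rw [one_rpow, mul_one] at a₁ b₁
  have key : (‖z.1‖ ^ μ / grho μ z ^ μ) ^ A * grho μ z ^ B =
      ‖z.1‖ ^ (μ * A) * grho μ z ^ (B - μ * A) := by
    rw [div_rpow (by positivity) (by positivity), ← rpow_mul (norm_nonneg _), ← rpow_mul hρ.le,
      rpow_sub hρ]
    ring
  rw [key, mul_assoc, mul_assoc]
  have := rpow_pos_of_pos hR0 (B - μ * A)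
  exact ⟨mul_le_mul a₁ a₂ (by positivity) (by positivity),
    mul_le_mul b₁ b₂ (by positivity) (by positivity)⟩

theorem norm_gradient_le_of_lipschitzWith {F : Type*} [NormedAddCommGroup F]
    [InnerProductSpace ℝ F] [CompleteSpace F] {f : F → ℝ} {K : NNReal} (hf : LipschitzWith K f)
    (x : F) : ‖gradient f x‖ ≤ K := by
  rw [gradient, LinearIsometryEquiv.norm_map]
  exact norm_fderiv_le_of_lipschitz ℝ hf

theorem gradMuNorm_nonneg (μ : ℝ) (u : EuclideanSpace ℝ (Fin d) × EuclideanSpace ℝ (Fin k) → ℝ)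
    (z : EuclideanSpace ℝ (Fin d) × EuclideanSpace ℝ (Fin k)) : 0 ≤ gradMuNorm μ u z :=
  Real.sqrt_nonneg _

theorem gradMuNorm_le_of_lipschitzWith (μ : ℝ)
    {u : EuclideanSpace ℝ (Fin d) × EuclideanSpace ℝ (Fin k) → ℝ} {K : NNReal}
    (hu : LipschitzWith K u) (z : EuclideanSpace ℝ (Fin d) × EuclideanSpace ℝ (Fin k)) :
    gradMuNorm μ u z ≤ (1 + ‖z.1‖ ^ μ) * K := by
  have h₁ : ‖gradient (fun x => u (x, z.2)) z.1‖ ≤ K := by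
    have := hu.comp (LipschitzWith.prodMk_right z.2)
    rw [mul_one] at this
    exact norm_gradient_le_of_lipschitzWith this _
  have h₂ : ‖gradient (fun y => u (z.1, y)) z.2‖ ≤ K := by
    have := hu.comp (LipschitzWith.prodMk_left z.1)
    rw [mul_one] at this
    exact norm_gradient_le_of_lipschitzWith this _
  have hx : 0 ≤ ‖z.1‖ ^ μ := by positivity
  have h₃ : ‖(‖z.1‖ ^ μ) • gradient (fun y => u (z.1, y)) z.2‖ ≤ ‖z.1‖ ^ μ * K := by
    rw [norm_smul, Real.norm_of_nonneg hx]
    exact mul_le_mul_of_nonneg_left h₂ hx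
  refine Real.sqrt_le_iff.2 ⟨by positivity, ?_⟩
  have h₁' := pow_le_pow_left₀ (norm_nonneg _) h₁ 2
  have h₃' := pow_le_pow_left₀ (norm_nonneg _) h₃ 2
  have hK := K.coe_nonneg
  simp only [gradMu]
  nlinarith [mul_nonneg hx (mul_nonneg hK hK)]

theorem gradMuNorm_eq_zero_of_notMem_tsupport (μ : ℝ)
    {u : EuclideanSpace ℝ (Fin d) × EuclideanSpace ℝ (Fin k) → ℝ}
    {z : EuclideanSpace ℝ (Fin d) × EuclideanSpace ℝ (Fin k)} (hz : z ∉ tsupport u) :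
    gradMuNorm μ u z = 0 := by
  have h0 : u =ᶠ[nhds z] 0 := notMem_tsupport_iff_eventuallyEq.1 hz
  have h₁ : (fun x => u (x, z.2)) =ᶠ[nhds z.1] fun _ => 0 :=
    (Continuous.prodMk_left z.2).continuousAt h0
  have h₂ : (fun y => u (z.1, y)) =ᶠ[nhds z.2] fun _ => 0 :=
    (Continuous.prodMk_right z.1).continuousAt h0
  simp [gradMuNorm, pairNorm, gradMu, gradient, h₁.fderiv_eq, h₂.fderiv_eq]

end Grushin

theorem integral_le_of_le_on_closedBall {E : Type*} [NormedAddCommGroup E] [NormedSpace ℝ E]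
    [FiniteDimensional ℝ E] [MeasurableSpace E] [BorelSpace E] (ν : Measure E)
    [ν.IsAddHaarMeasure] {f : E → ℝ} {c : E} {R N : ℝ} (hf : ∀ z, 0 ≤ f z)
    (hN : ∀ z ∈ Metric.closedBall c R, f z ≤ N) (h0 : ∀ z ∉ Metric.closedBall c R, f z = 0) :
    ∫ z, f z ∂ν ≤ ν.real (Metric.closedBall 0 R) * N := by
  have hfin : ν (Metric.closedBall c R) ≠ ⊤ := measure_closedBall_lt_top.ne
  have hle : f ≤ (Metric.closedBall c R).indicator fun _ => N := by
    intro z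
    by_cases hz : z ∈ Metric.closedBall c R
    · simpa [hz] using hN z hz
    · rw [Set.indicator_of_notMem hz, h0 z hz]
  have hint : Integrable ((Metric.closedBall c R).indicator fun _ => N) ν :=
    (integrable_indicator_iff measurableSet_closedBall).2 (integrableOn_const hfin)
  refine (integral_mono_of_nonneg (.of_forall hf) hint (.of_forall hle)).trans_eq ?_
  rw [integral_indicator_const _ measurableSet_closedBall, smul_eq_mul, Measure.real,
    Measure.addHaar_closedBall_center, Measure.real]

theorem le_integral_of_le_on_closedBall {E : Type*} [NormedAddCommGroup E] [NormedSpace ℝ E]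
    [FiniteDimensional ℝ E] [MeasurableSpace E] [BorelSpace E] (ν : Measure E)
    [ν.IsAddHaarMeasure] {f : E → ℝ} {c : E} {R R' N N' : ℝ} (hm : Measurable f)
    (hf : ∀ z, 0 ≤ f z) (hN : ∀ z ∈ Metric.closedBall c R, f z ≤ N)
    (h0 : ∀ z ∉ Metric.closedBall c R, f z = 0) (hN' : ∀ z ∈ Metric.closedBall c R', N' ≤ f z) :
    ν.real (Metric.closedBall 0 R') * N' ≤ ∫ z, f z ∂ν := by
  have hfin : ∀ S, ν (Metric.closedBall c S) ≠ ⊤ := fun S => measure_closedBall_lt_top.ne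
  have hint : ∀ S T : ℝ, Integrable ((Metric.closedBall c S).indicator fun _ => T) ν := fun S T =>
    (integrable_indicator_iff measurableSet_closedBall).2 (integrableOn_const (hfin S))
  have hfi : Integrable f ν := by
    refine (hint R N).mono' hm.aestronglyMeasurable (.of_forall fun z => ?_)
    rw [Real.norm_of_nonneg (hf z)]
    by_cases hz : z ∈ Metric.closedBall c R
    · simpa [hz] using hN z hz
    · rw [Set.indicator_of_notMem hz, h0 z hz]
  have hle : ((Metric.closedBall c R').indicator fun _ => N') ≤ f := by
    intro z
    by_cases hz : z ∈ Metric.closedBall c R'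
    · simpa [hz] using hN' z hz
    · rw [Set.indicator_of_notMem hz]
      exact hf z
  refine Eq.trans_le ?_ (integral_mono (hint R' N') hfi hle)
  rw [integral_indicator_const _ measurableSet_closedBall, smul_eq_mul, Measure.real, Measure.real,
    Measure.addHaar_closedBall_center ν c]

theorem le_of_forall_mul_rpow_le {c C s t : ℝ} (hc : 0 < c)
    (h : ∀ R : ℝ, 1 ≤ R → c * R ^ s ≤ C * R ^ t) : s ≤ t := by
  by_contra! hst
  have hlim : Filter.Tendsto (fun R : ℝ => c * R ^ (s - t)) Filter.atTop Filter.atTop :=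
    (tendsto_rpow_atTop (sub_pos.2 hst)).const_mul_atTop hc
  obtain ⟨R, hR, hCR⟩ := ((Filter.eventually_ge_atTop (1 : ℝ)).and
    (hlim.eventually_gt_atTop C)).exists
  have hR0 : 0 < R := by linarith
  have hpos := rpow_pos_of_pos hR0 t
  have := h R hR
  rw [show s = (s - t) + t by ring, rpow_add hR0, ← mul_assoc] at this
  exact absurd (le_of_mul_le_mul_right this hpos) (not_le.2 hCR)

/-- Smooth bumps with a common Lipschitz constant, at every centre. -/
theorem exists_smooth_bumps (E : Type*) [NormedAddCommGroup E] [NormedSpace ℝ E]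
    [FiniteDimensional ℝ E] :
    ∃ K : NNReal, ∀ c : E, ∃ u : E → ℝ, ContDiff ℝ (⊤ : ℕ∞) u ∧ HasCompactSupport u ∧
      LipschitzWith K u ∧ tsupport u ⊆ Metric.closedBall c (1 / 2) ∧ (∀ z, |u z| ≤ 1) ∧
      ∀ z ∈ Metric.closedBall c (1 / 4), u z = 1 := by
  let v : ContDiffBump (0 : E) := ⟨1 / 4, 1 / 2, by norm_num, by norm_num⟩
  have hv : ContDiff ℝ (⊤ : ℕ∞) v := v.contDiff
  obtain ⟨K, hK⟩ := hv.lipschitzWith_of_hasCompactSupport v.hasCompactSupport (by simp)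
  refine ⟨K, fun c => ⟨fun z => v (z - c), hv.comp (contDiff_id.sub contDiff_const),
    ?_, ?_, ?_, ?_, ?_⟩⟩
  · exact v.hasCompactSupport.comp_homeomorph (Homeomorph.subRight c)
  · have h := hK.comp (LipschitzWith.of_dist_le_mul (K := 1) (f := fun z : E => z - c) (by simp))
    rwa [mul_one] at h
  · refine closure_minimal (fun z hz => ?_) Metric.isClosed_closedBall
    have : z - c ∈ Function.support v := hz
    rw [v.support_eq, Metric.mem_ball, dist_zero_right] at this
    rw [Metric.mem_closedBall, dist_eq_norm]
    exact this.le
  · intro z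
    rw [abs_of_nonneg v.nonneg]
    exact v.le_one
  · intro z hz
    refine v.one_of_mem_closedBall ?_
    rw [mem_closedBall_zero_iff]
    rwa [Metric.mem_closedBall, dist_eq_norm] at hz

/-- Necessity of `σ ≤ α` in the weighted CKN inequality. -/
theorem weighted_CKN_grushin_necessity_sigma_le_alpha
    (d k : ℕ) (hd : 1 ≤ d) (hk : 1 ≤ k) (μ : ℝ) (hμ : 0 < μ)
    (Q : ℝ) (hQ : Q = d + (1 + μ) * k)
    (p q r a α β σ γ : ℝ)
    (hγ : γ = a * σ + (1 - a) * β)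
    (hp1 : 1 < p) (hpQ : p < Q) (hq : 1 ≤ q) (hr : 0 < r)
    (h1 : 0 < d + μ * (α - γ) * r) (h2 : 0 < d + μ * (α - β) * q)
    (h3 : 0 < α * p + Q) (h4 : 0 < β * q + Q) (h5 : 0 < γ * r + Q)
    (ha0 : 0 < a) (ha1 : a ≤ 1)
    (hCKN : ∃ C : ℝ, 0 < C ∧
        ∀ u : EuclideanSpace ℝ (Fin d) × EuclideanSpace ℝ (Fin k) → ℝ,
          ContDiff ℝ (⊤ : ℕ∞) u → HasCompactSupport u →
          (∫ z, (‖z.1‖ ^ μ / grho μ z ^ μ) ^ ((α - γ) * r) * grho μ z ^ (γ * r) * |u z| ^ r) ^ (1 / r)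
            ≤ C * (∫ z, grho μ z ^ (α * p) * gradMuNorm μ u z ^ p) ^ (a / p) *
              (∫ z, (‖z.1‖ ^ μ / grho μ z ^ μ) ^ ((α - β) * q) * grho μ z ^ (β * q) * |u z| ^ q) ^
                ((1 - a) / q)) :
    σ ≤ α := by
  obtain ⟨C, hC, H⟩ := hCKN
  let e : EuclideanSpace ℝ (Fin d) := EuclideanSpace.single ⟨0, hd⟩ 1
  let f : EuclideanSpace ℝ (Fin k) := EuclideanSpace.single ⟨0, hk⟩ 1
  have he : ‖e‖ = 1 := by simp [e]
  have hf : ‖f‖ = 1 := by simp [f]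
  have hp0 : 0 < p := by linarith
  have hq0 : 0 < q := by linarith
  obtain ⟨K, hK⟩ := exists_smooth_bumps (EuclideanSpace ℝ (Fin d) × EuclideanSpace ℝ (Fin k))
  obtain ⟨m₁, M₁, hm₁, hM₁, W₁⟩ :=
    exists_weight_bounds (k := k) hμ he ((α - γ) * r) (γ * r)
  obtain ⟨m₂, M₂, hm₂, hM₂, W₂⟩ := exists_weight_bounds (k := k) hμ he 0 (α * p)
  obtain ⟨m₃, M₃, hm₃, hM₃, W₃⟩ :=
    exists_weight_bounds (k := k) hμ he ((α - β) * q) (β * q)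
  simp only [rpow_zero, one_mul, mul_zero, sub_zero] at W₂
  let ν : Measure (EuclideanSpace ℝ (Fin d) × EuclideanSpace ℝ (Fin k)) := volume
  have hνH : ν.IsAddHaarMeasure :=
    inferInstanceAs (((volume : Measure (EuclideanSpace ℝ (Fin d))).prod
      (volume : Measure (EuclideanSpace ℝ (Fin k)))).IsAddHaarMeasure)
  have hV : ∀ s : ℝ, 0 < s → 0 < ν.real (Metric.closedBall 0 s) := fun s hs =>
    ENNReal.toReal_pos (Metric.measure_closedBall_pos ν 0 hs).ne' measure_closedBall_lt_top.ne
  set V := ν.real (Metric.closedBall 0 (1 / 2))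
  set V' := ν.real (Metric.closedBall 0 (1 / 4))
  have hV0 : 0 < V := hV _ (by norm_num)
  have hV0' : 0 < V' := hV _ (by norm_num)
  set G : ℝ := ((1 + (3 / 2) ^ μ) * K) ^ p
  have hG : 0 ≤ G := by positivity
  have key : ∀ R : ℝ, 1 ≤ R →
      (V' * m₁) ^ (1 / r) * R ^ (γ - μ * (α - γ)) ≤
        (C * (V * (M₂ * G)) ^ (a / p) * (V * M₃) ^ ((1 - a) / q)) *
          R ^ (a * α + (1 - a) * (β - μ * (α - β))) := by
    intro R hR
    have hR0 : 0 < R := by linarith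
    have hy : ‖(R ^ (1 + μ)) • f‖ = R ^ (1 + μ) := by
      rw [norm_smul, hf, mul_one, Real.norm_of_nonneg (by positivity)]
    obtain ⟨u, hu, hcs, hL, hts, hu1, hu2⟩ := hK (e, (R ^ (1 + μ)) • f)
    have hu0 : ∀ z ∉ Metric.closedBall (e, (R ^ (1 + μ)) • f) (1 / 2), u z = 0 := fun z hz =>
      image_eq_zero_of_notMem_tsupport fun h => hz (hts h)
    have hw : ∀ (A B : ℝ) (z : EuclideanSpace ℝ (Fin d) × EuclideanSpace ℝ (Fin k)),
        0 ≤ (‖z.1‖ ^ μ / grho μ z ^ μ) ^ A * grho μ z ^ B := fun A B z => by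
      have := grho_nonneg μ z
      positivity
    have hpow : ∀ (s : ℝ), 0 < s → ∀ z, |u z| ^ s ≤ 1 := fun s hs z =>
      rpow_le_one (abs_nonneg _) (hu1 z) hs.le
    have hmeas : ∀ A B s : ℝ, Measurable fun z =>
        (‖z.1‖ ^ μ / grho μ z ^ μ) ^ A * grho μ z ^ B * |u z| ^ s := fun A B s => by
      have := hu.continuous.measurable
      unfold grho
      fun_prop
    have I₁ : V' * (m₁ * R ^ (γ * r - μ * ((α - γ) * r))) ≤
        ∫ z, (‖z.1‖ ^ μ / grho μ z ^ μ) ^ ((α - γ) * r) * grho μ z ^ (γ * r) * |u z| ^ r := by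
      refine le_integral_of_le_on_closedBall ν (c := (e, (R ^ (1 + μ)) • f)) (R := 1 / 2)
        (N := M₁ * R ^ (γ * r - μ * ((α - γ) * r))) (hmeas _ _ _)
        (fun z => mul_nonneg (hw _ _ z) (by positivity)) (fun z hz => ?_) (fun z hz => ?_)
        fun z hz => ?_
      · exact (mul_le_of_le_one_right (hw _ _ z) (hpow r hr z)).trans (W₁ R hR _ hy z hz).2
      · rw [hu0 z hz, abs_zero, zero_rpow hr.ne', mul_zero]
      · rw [hu2 z hz, abs_one, one_rpow, mul_one]
        exact (W₁ R hR _ hy z (Metric.closedBall_subset_closedBall (by norm_num) hz)).1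
    have I₂ : ∫ z, grho μ z ^ (α * p) * gradMuNorm μ u z ^ p ≤
        V * (M₂ * R ^ (α * p) * G) := by
      refine integral_le_of_le_on_closedBall ν (c := (e, (R ^ (1 + μ)) • f))
        (fun z => mul_nonneg (rpow_nonneg (grho_nonneg μ z) _)
          (rpow_nonneg (gradMuNorm_nonneg μ u z) _)) (fun z hz => ?_) fun z hz => ?_
      · refine mul_le_mul (W₂ R hR _ hy z hz).2 ?_ (rpow_nonneg (gradMuNorm_nonneg μ u z) _)
          (by positivity)
        refine rpow_le_rpow (gradMuNorm_nonneg μ u z)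
          ((gradMuNorm_le_of_lipschitzWith μ hL z).trans ?_) hp0.le
        have := rpow_le_rpow (norm_nonneg _) (norm_fst_mem_of_mem_closedBall he hz).2 hμ.le
        gcongr
      · rw [gradMuNorm_eq_zero_of_notMem_tsupport μ fun h => hz (hts h), zero_rpow hp0.ne',
          mul_zero]
    have I₃ : ∫ z, (‖z.1‖ ^ μ / grho μ z ^ μ) ^ ((α - β) * q) * grho μ z ^ (β * q) * |u z| ^ q ≤
        V * (M₃ * R ^ (β * q - μ * ((α - β) * q))) := by
      refine integral_le_of_le_on_closedBall ν (c := (e, (R ^ (1 + μ)) • f))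
        (fun z => mul_nonneg (hw _ _ z) (by positivity)) (fun z hz => ?_) fun z hz => ?_
      · exact (mul_le_of_le_one_right (hw _ _ z) (hpow q hq0 z)).trans (W₃ R hR _ hy z hz).2
      · rw [hu0 z hz, abs_zero, zero_rpow hq0.ne', mul_zero]
    have J₂ : 0 ≤ ∫ z, grho μ z ^ (α * p) * gradMuNorm μ u z ^ p :=
      integral_nonneg fun z => mul_nonneg (rpow_nonneg (grho_nonneg μ z) _)
        (rpow_nonneg (gradMuNorm_nonneg μ u z) _)
    have J₃ : 0 ≤ ∫ z, (‖z.1‖ ^ μ / grho μ z ^ μ) ^ ((α - β) * q) * grho μ z ^ (β * q) *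
        |u z| ^ q := integral_nonneg fun z => mul_nonneg (hw _ _ z) (by positivity)
    have L₁ := rpow_le_rpow (by positivity) I₁ (by positivity : 0 ≤ 1 / r)
    have L₂ := rpow_le_rpow J₂ I₂ (by positivity : 0 ≤ a / p)
    have L₃ := rpow_le_rpow J₃ I₃ (div_nonneg (by linarith) hq0.le : 0 ≤ (1 - a) / q)
    have E₁ : (V' * (m₁ * R ^ (γ * r - μ * ((α - γ) * r)))) ^ (1 / r) =
        (V' * m₁) ^ (1 / r) * R ^ (γ - μ * (α - γ)) := by
      rw [← mul_assoc, mul_rpow (by positivity) (by positivity), ← rpow_mul hR0.le]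
      congr 2
      field_simp
    have E₂ : (V * (M₂ * R ^ (α * p) * G)) ^ (a / p) =
        (V * (M₂ * G)) ^ (a / p) * R ^ (a * α) := by
      rw [show V * (M₂ * R ^ (α * p) * G) = V * (M₂ * G) * R ^ (α * p) by ring,
        mul_rpow (by positivity) (by positivity), ← rpow_mul hR0.le]
      congr 2
      field_simp
    have E₃ : (V * (M₃ * R ^ (β * q - μ * ((α - β) * q)))) ^ ((1 - a) / q) =
        (V * M₃) ^ ((1 - a) / q) * R ^ ((1 - a) * (β - μ * (α - β))) := by
      rw [← mul_assoc, mul_rpow (by positivity) (by positivity), ← rpow_mul hR0.le]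
      congr 2
      field_simp
    rw [E₁] at L₁
    rw [E₂] at L₂
    rw [E₃] at L₃
    refine (L₁.trans (H u hu hcs)).trans ((mul_le_mul (mul_le_mul_of_nonneg_left L₂ hC.le) L₃
      (rpow_nonneg J₃ _) (by positivity)).trans_eq ?_)
    rw [rpow_add hR0]
    ring
  have hexp := le_of_forall_mul_rpow_le (by positivity) key
  have hprod : (1 + μ) * a * (σ - α) ≤ 0 := by
    subst hγ
    linarith
  have := nonpos_of_mul_nonpos_right hprod (by positivity)
  linarith
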